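/- Let A be a closed, monotone subset of E × E*. Then A is quasidense if and only if for every (w, w*) ∈ E × E* there exists τ ≥ 0 such that (τ, τ) is a negative alignment pair for A with respect to (w, w*). -/

import Mathlib

noncomputable section

open Filter Topology

variable {E : Type*} [NormedAddCommGroup E] [NormedSpace ℝ E]

/-- `A ⊆ E × E*` is a monotone set. -/
def MonotoneSet (A : Set (E × (E →L[ℝ] ℝ))) : Prop :=
  A.Nonempty ∧ ∀ p ∈ A, ∀ q ∈ A, 0 ≤ (p.2 - q.2) (p.1 - q.1)

/-- `A ⊆ E × E*` is maximally monotone. -/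
def MaxMonotone (A : Set (E × (E →L[ℝ] ℝ))) : Prop :=
  MonotoneSet A ∧ ∀ A' : Set (E × (E →L[ℝ] ℝ)), MonotoneSet A' → A ⊆ A' → A' = A

/-- `r_L((s,s*) - (x,x*)) = (1/2)‖s - x‖² + (1/2)‖s* - x*‖² + ⟨s - x, s* - x*⟩`. -/
def rQ (q p : E × (E →L[ℝ] ℝ)) : ℝ :=
  (1 / 2) * ‖q.1 - p.1‖ ^ 2 + (1 / 2) * ‖q.2 - p.2‖ ^ 2 + (q.2 - p.2) (q.1 - p.1)

/-- `A ⊆ E × E*` is quasidense. -/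
def Quasidense (A : Set (E × (E →L[ℝ] ℝ))) : Prop :=
  ∀ p : E × (E →L[ℝ] ℝ), (⨅ q ∈ A, ((rQ q p : ℝ) : EReal)) ≤ 0

/-- `A ⊆ E × E*` is stably quasidense (with the norm
`‖(x, x*)‖ = (‖x‖² + ‖x*‖²)^{1/2}` on `E × E*`). -/
def StablyQuasidense (A : Set (E × (E →L[ℝ] ℝ))) : Prop :=
  ∀ p : E × (E →L[ℝ] ℝ), ∃ K : ℝ, 0 ≤ K ∧
    (⨅ q ∈ {q ∈ A | Real.sqrt (‖q.1 - p.1‖ ^ 2 + ‖q.2 - p.2‖ ^ 2) ≤ K},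
      ((rQ q p : ℝ) : EReal)) ≤ 0

/-- `(ρ, σ)` is a negative alignment pair for `A` with respect to `w = (w, w*)`. -/
def NegAlignPair (A : Set (E × (E →L[ℝ] ℝ))) (w : E × (E →L[ℝ] ℝ)) (ρ σ : ℝ) : Prop :=
  ∃ s : ℕ → E × (E →L[ℝ] ℝ), (∀ n, s n ∈ A) ∧
    Tendsto (fun n => ‖(s n).1 - w.1‖) atTop (𝓝 ρ) ∧
    Tendsto (fun n => ‖(s n).2 - w.2‖) atTop (𝓝 σ) ∧
    Tendsto (fun n => ((s n).2 - w.2) ((s n).1 - w.1)) atTop (𝓝 (-(ρ * σ)))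

/-- Half the squared difference of the two norms is a lower bound for `rQ`. -/
lemma half_sq_norm_sub_norm_le_rQ (q p : E × (E →L[ℝ] ℝ)) :
    (1 / 2) * (‖q.1 - p.1‖ - ‖q.2 - p.2‖) ^ 2 ≤ rQ q p := by
  have h := (abs_le.1 ((q.2 - p.2).le_opNorm (q.1 - p.1))).1
  unfold rQ
  linarith

/-- Points of a monotone set at which `rQ` is small stay at bounded distance. -/
lemma MonotoneSet.exists_norm_sub_le {A : Set (E × (E →L[ℝ] ℝ))} (hA : MonotoneSet A)
    (w : E × (E →L[ℝ] ℝ)) : ∃ M : ℝ, ∀ q ∈ A, rQ q w ≤ 1 → ‖q.1 - w.1‖ ≤ M := by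
  obtain ⟨⟨a, ha⟩, hm⟩ := hA
  set β := ‖a.1 - w.1‖
  set γ := ‖a.2 - w.2‖
  refine ⟨γ + (2 + β ^ 2 + 2 * (γ * β) + γ ^ 2) + 1, fun q hq hr => ?_⟩
  have h0 := hm q hq a ha
  have e : (q.2 - a.2) (q.1 - a.1) = (q.2 - w.2) (q.1 - w.1) - (q.2 - w.2) (a.1 - w.1)
      - (a.2 - w.2) (q.1 - w.1) + (a.2 - w.2) (a.1 - w.1) := by
    simp only [sub_apply, map_sub]
    ring
  have h1 := (abs_le.1 ((q.2 - w.2).le_opNorm (a.1 - w.1))).1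
  have h2 := (abs_le.1 ((a.2 - w.2).le_opNorm (q.1 - w.1))).1
  have h3 := (abs_le.1 ((a.2 - w.2).le_opNorm (a.1 - w.1))).2
  unfold rQ at hr
  nlinarith [sq_nonneg (‖q.2 - w.2‖ - β), sq_nonneg (‖q.1 - w.1‖ - γ - 1),
    sq_nonneg (‖q.1 - w.1‖ - γ)]

/-- A quasidense set contains points at which `rQ` is arbitrarily small. -/
lemma Quasidense.exists_rQ_lt {A : Set (E × (E →L[ℝ] ℝ))} (hA : Quasidense A)
    (w : E × (E →L[ℝ] ℝ)) {ε : ℝ} (hε : 0 < ε) : ∃ q ∈ A, rQ q w < ε := by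
  have h : (⨅ q ∈ A, ((rQ q w : ℝ) : EReal)) < (ε : EReal) :=
    (hA w).trans_lt (by exact_mod_cast hε)
  simpa only [iInf_lt_iff, EReal.coe_lt_coe_iff, exists_prop] using h

/-- A sequence of points in a quasidense monotone set along which `rQ` vanishes has a subsequence
realizing a negative alignment pair with equal entries. -/
lemma Quasidense.exists_negAlignPair {A : Set (E × (E →L[ℝ] ℝ))} (hA : Quasidense A)
    (hm : MonotoneSet A) (w : E × (E →L[ℝ] ℝ)) : ∃ τ : ℝ, 0 ≤ τ ∧ NegAlignPair A w τ τ := by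
  choose s hsA hs using fun n : ℕ => hA.exists_rQ_lt w (Nat.one_div_pos_of_nat (α := ℝ) (n := n))
  obtain ⟨M, hM⟩ := hm.exists_norm_sub_le w
  have hr : Tendsto (fun n => rQ (s n) w) atTop (𝓝 0) :=
    squeeze_zero (fun n => (by positivity : (0 : ℝ) ≤ _).trans
      (half_sq_norm_sub_norm_le_rQ (s n) w)) (fun n => (hs n).le)
      tendsto_one_div_add_atTop_nhds_zero_nat
  have hle (n : ℕ) : rQ (s n) w ≤ 1 := by
    refine (hs n).le.trans ?_
    rw [div_le_one (by positivity)]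
    linarith [n.cast_nonneg (α := ℝ)]
  obtain ⟨τ, hτ, φ, hφ, hlim⟩ := (isCompact_Icc (a := (0 : ℝ)) (b := M)).tendsto_subseq
    (x := fun n => ‖(s n).1 - w.1‖) fun n => ⟨norm_nonneg _, hM _ (hsA n) (hle n)⟩
  have hlim₁ : Tendsto (fun n => ‖(s (φ n)).1 - w.1‖) atTop (𝓝 τ) := hlim
  have hrφ : Tendsto (fun n => rQ (s (φ n)) w) atTop (𝓝 0) := hr.comp hφ.tendsto_atTop
  have hsq : Tendsto (fun n => (‖(s (φ n)).1 - w.1‖ - ‖(s (φ n)).2 - w.2‖) ^ 2) atTop (𝓝 0) :=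
    squeeze_zero (g := fun n => 2 * rQ (s (φ n)) w) (fun n => sq_nonneg _)
      (fun n => by linarith [half_sq_norm_sub_norm_le_rQ (s (φ n)) w])
      (by simpa using hrφ.const_mul 2)
  have hdiff : Tendsto (fun n => ‖(s (φ n)).1 - w.1‖ - ‖(s (φ n)).2 - w.2‖) atTop (𝓝 0) := by
    rw [tendsto_zero_iff_abs_tendsto_zero]
    simpa [Function.comp_def, Real.sqrt_sq_eq_abs] using hsq.sqrt
  have hlim₂ : Tendsto (fun n => ‖(s (φ n)).2 - w.2‖) atTop (𝓝 τ) := by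
    simpa using hlim₁.sub hdiff
  refine ⟨τ, hτ.1, fun n => s (φ n), fun n => hsA _, hlim₁, hlim₂, ?_⟩
  have h := (hrφ.sub ((hlim₁.pow 2).const_mul (1 / 2))).sub ((hlim₂.pow 2).const_mul (1 / 2))
  convert h using 2
  · unfold rQ
    ring
  · ring

/-- A negative alignment pair with equal entries forces the infimum of `rQ` to be nonpositive. -/
lemma NegAlignPair.iInf_rQ_le_zero {A : Set (E × (E →L[ℝ] ℝ))} {w : E × (E →L[ℝ] ℝ)} {τ : ℝ}
    (h : NegAlignPair A w τ τ) : (⨅ q ∈ A, ((rQ q w : ℝ) : EReal)) ≤ 0 := by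
  obtain ⟨s, hsA, h₁, h₂, h₃⟩ := h
  have hr : Tendsto (fun n => rQ (s n) w) atTop (𝓝 0) := by
    have h := (((h₁.pow 2).const_mul (1 / 2)).add ((h₂.pow 2).const_mul (1 / 2))).add h₃
    convert h using 2
    · rfl
    · ring
  have hE : Tendsto (fun n => ((rQ (s n) w : ℝ) : EReal)) atTop (𝓝 ((0 : ℝ) : EReal)) :=
    (continuous_coe_real_ereal.tendsto 0).comp hr
  exact ge_of_tendsto' hE fun n => iInf₂_le (s n) (hsA n)

theorem statement17 [CompleteSpace E] [Nontrivial E]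
    (A : Set (E × (E →L[ℝ] ℝ))) (hclosed : IsClosed A) (hmono : MonotoneSet A) :
    Quasidense A ↔
      ∀ w : E × (E →L[ℝ] ℝ), ∃ τ : ℝ, 0 ≤ τ ∧ NegAlignPair A w τ τ := by
  exact ⟨fun h => h.exists_negAlignPair hmono, fun h w => by
    obtain ⟨τ, -, hτ⟩ := h w
    exact hτ.iInf_rQ_le_zero⟩
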